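/- Let p > 1 and let μ ∈ P_p([0,∞)) satisfy μ([0,ε]) = 0 for some ε > 0. Then the Wasserstein projection μ̂ = proj_{F_{m,p}}^{(p)} μ is absolutely continuous with a non-increasing density on [0,∞); equivalently, its quantile function Q_μ̂ is strictly increasing on (0,1) with lim_{u↓0} Q_μ̂(u) = 0. -/

import Mathlib

open MeasureTheory Set Filter

noncomputable def quantile (μ : MeasureTheory.Measure ℝ) (u : ℝ) : ℝ :=
  sInf {x : ℝ | u ≤ (μ (Set.Iic x)).toReal}

def HasFiniteMomentP (p : ℝ) (μ : MeasureTheory.Measure ℝ) : Prop :=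
  MeasureTheory.IsProbabilityMeasure μ ∧
    MeasureTheory.Integrable (fun x => |x| ^ p) μ

noncomputable def Wdist (p : ℝ) (μ ν : MeasureTheory.Measure ℝ) : ℝ :=
  (∫ u in Set.Ioo (0:ℝ) 1, |quantile μ u - quantile ν u| ^ p) ^ (1 / p)

def DisplacementConvex (F : Set (MeasureTheory.Measure ℝ)) : Prop :=
  ∀ μ ∈ F, ∀ ν ∈ F, ∀ t ∈ Set.Icc (0:ℝ) 1, ∃ σ ∈ F,
    ∀ u ∈ Set.Ioo (0:ℝ) 1,
      quantile σ u = (1 - t) * quantile μ u + t * quantile ν u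

def WClosed (p : ℝ) (F : Set (MeasureTheory.Measure ℝ)) : Prop :=
  ∀ (μs : ℕ → MeasureTheory.Measure ℝ) (μ : MeasureTheory.Measure ℝ),
    (∀ n, μs n ∈ F) → HasFiniteMomentP p μ →
    Filter.Tendsto (fun n => Wdist p (μs n) μ) Filter.atTop (nhds 0) → μ ∈ F

/-- The model `F_{m,p}`: probability measures on `[0,∞)` with finite `p`-th moment whose
quantile function is convex, non-decreasing, and tends to `0` as `u ↓ 0`. -/
def Fmp (p : ℝ) : Set (MeasureTheory.Measure ℝ) :=
  {μ | HasFiniteMomentP p μ ∧ μ (Set.Iio (0:ℝ)) = 0 ∧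
    ConvexOn ℝ (Set.Ioo (0:ℝ) 1) (quantile μ) ∧
    MonotoneOn (quantile μ) (Set.Ioo (0:ℝ) 1) ∧
    Filter.Tendsto (quantile μ) (nhdsWithin 0 (Set.Ioi 0)) (nhds 0)}

lemma quantile_le_iff (μ : Measure ℝ) [IsProbabilityMeasure μ] {u x : ℝ} (hu : u ∈ Ioo (0 : ℝ) 1) :
    quantile μ u ≤ x ↔ u ≤ μ.real (Iic x) := by
  have hmono : Monotone fun x : ℝ => μ.real (Iic x) := fun a b hab =>
    measureReal_mono (Iic_subset_Iic.2 hab)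
  have hcdf : ∀ y, ProbabilityTheory.cdf μ y = μ.real (Iic y) := ProbabilityTheory.cdf_eq_real μ
  have hbdd : BddBelow {x : ℝ | u ≤ μ.real (Iic x)} := by
    obtain ⟨a, ha⟩ :=
      ((ProbabilityTheory.tendsto_cdf_atBot μ).eventually (gt_mem_nhds hu.1)).exists
    rw [hcdf] at ha
    refine ⟨a, fun y hy => ?_⟩
    by_contra! hlt
    exact absurd (hmono hlt.le) (not_le.2 (ha.trans_le hy))
  have hne : {x : ℝ | u ≤ μ.real (Iic x)}.Nonempty := by
    obtain ⟨a, ha⟩ :=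
      ((ProbabilityTheory.tendsto_cdf_atTop μ).eventually (lt_mem_nhds hu.2)).exists
    rw [hcdf] at ha
    exact ⟨a, ha.le⟩
  refine ⟨fun h => ?_, fun h => csInf_le hbdd h⟩
  have hright : Tendsto (ProbabilityTheory.cdf μ) (nhdsWithin x (Ioi x))
      (nhds (ProbabilityTheory.cdf μ x)) :=
    ((ProbabilityTheory.cdf μ).right_continuous x).mono_left
      (nhdsWithin_mono x Ioi_subset_Ici_self)
  rw [← hcdf]
  refine ge_of_tendsto hright ?_
  filter_upwards [self_mem_nhdsWithin] with y hy
  obtain ⟨s, hs, hsy⟩ := exists_lt_of_csInf_lt hne (lt_of_le_of_lt h hy)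
  rw [hcdf]
  exact le_trans hs (hmono hsy.le)

lemma monotoneOn_quantile (μ : Measure ℝ) [IsProbabilityMeasure μ] :
    MonotoneOn (quantile μ) (Ioo 0 1) := fun _ hu _ hv huv =>
  (quantile_le_iff μ hu).2 (huv.trans ((quantile_le_iff μ hv).1 le_rfl))

lemma aemeasurable_quantile (μ : Measure ℝ) [IsProbabilityMeasure μ] :
    AEMeasurable (quantile μ) (volume.restrict (Ioo 0 1)) :=
  aemeasurable_restrict_of_monotoneOn measurableSet_Ioo (monotoneOn_quantile μ)

lemma volume_Iic_inter_Ioo_zero_one {c : ℝ} (hc : c ≤ 1) :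
    volume (Iic c ∩ Ioo (0 : ℝ) 1) = ENNReal.ofReal c := by
  apply le_antisymm
  · calc volume (Iic c ∩ Ioo (0 : ℝ) 1) ≤ volume (Ioc 0 c) :=
          measure_mono fun x hx => ⟨hx.2.1, hx.1⟩
      _ = ENNReal.ofReal c := by simp
  · calc ENNReal.ofReal c = volume (Ioo 0 c) := by simp
      _ ≤ volume (Iic c ∩ Ioo (0 : ℝ) 1) :=
          measure_mono fun x hx => ⟨hx.2.le, hx.1, hx.2.trans_le hc⟩

instance isProbabilityMeasure_restrict_Ioo_zero_one :
    IsProbabilityMeasure (volume.restrict (Ioo (0 : ℝ) 1)) := ⟨by simp⟩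

/-- The quantile function pushes the uniform distribution on `(0,1)` forward to the measure. -/
lemma map_quantile (μ : Measure ℝ) [IsProbabilityMeasure μ] :
    (volume.restrict (Ioo (0 : ℝ) 1)).map (quantile μ) = μ := by
  have := Measure.isProbabilityMeasure_map (aemeasurable_quantile μ)
  refine Measure.ext_of_Iic _ _ fun x => ?_
  rw [Measure.map_apply_of_aemeasurable (aemeasurable_quantile μ) measurableSet_Iic,
    Measure.restrict_apply' measurableSet_Ioo]
  have : quantile μ ⁻¹' Iic x ∩ Ioo 0 1 = Iic (μ.real (Iic x)) ∩ Ioo 0 1 := by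
    ext u
    exact and_congr_left fun hu => quantile_le_iff μ hu
  rw [this, volume_Iic_inter_Ioo_zero_one measureReal_le_one, ofReal_measureReal]

lemma memLp_quantile {p : ℝ} (hp : 0 < p) {μ : Measure ℝ} (hμ : HasFiniteMomentP p μ) :
    MemLp (quantile μ) (ENNReal.ofReal p) (volume.restrict (Ioo 0 1)) := by
  have := hμ.1
  have h : MemLp id (ENNReal.ofReal p) μ := by
    rw [← integrable_norm_rpow_iff aestronglyMeasurable_id (by simpa using hp) (by simp)]
    simpa [ENNReal.toReal_ofReal hp.le] using hμ.2
  rw [← map_quantile μ] at h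
  exact (memLp_map_measure_iff aestronglyMeasurable_id (aemeasurable_quantile μ)).1 h

lemma MeasureTheory.MemLp.integrable_abs_rpow {α : Type*} [MeasurableSpace α] {m : Measure α}
    {p : ℝ} (hp : 0 < p) {f : α → ℝ} (hf : MemLp f (ENNReal.ofReal p) m) :
    Integrable (fun x => |f x| ^ p) m := by
  simpa [ENNReal.toReal_ofReal hp.le] using
    hf.integrable_norm_rpow (by simpa using hp) (by simp)

/-- A continuous non-decreasing function on `(0,1)` is the quantile function of its law. -/
lemma quantile_map {G : ℝ → ℝ} (hG : MonotoneOn G (Ioo 0 1)) (hc : ContinuousOn G (Ioo 0 1))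
    {u : ℝ} (hu : u ∈ Ioo (0 : ℝ) 1) :
    quantile ((volume.restrict (Ioo (0 : ℝ) 1)).map G) u = G u := by
  have hm : AEMeasurable G (volume.restrict (Ioo 0 1)) :=
    aemeasurable_restrict_of_monotoneOn measurableSet_Ioo hG
  have := Measure.isProbabilityMeasure_map hm
  refine eq_of_forall_ge_iff fun x => ?_
  rw [quantile_le_iff _ hu, measureReal_def, ← ENNReal.ofReal_le_iff_le_toReal (measure_ne_top _ _),
    Measure.map_apply_of_aemeasurable hm measurableSet_Iic,
    Measure.restrict_apply' measurableSet_Ioo]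
  constructor
  · intro h
    by_contra! hlt
    have hev : ∀ᶠ v in nhdsWithin u (Iio u), x < G v :=
      (((hc.continuousAt (isOpen_Ioo.mem_nhds hu)).eventually
        (lt_mem_nhds hlt))).filter_mono nhdsWithin_le_nhds
    obtain ⟨v, hxv, hv⟩ := (hev.and (Ioo_mem_nhdsLT hu.1)).exists
    have hsub : G ⁻¹' Iic x ∩ Ioo 0 1 ⊆ Iic v ∩ Ioo 0 1 := fun w hw =>
      ⟨le_of_not_gt fun hvw => absurd (hG ⟨hv.1, hv.2.trans hu.2⟩ hw.2 hvw.le)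
        (not_le.2 (lt_of_le_of_lt hw.1 hxv)), hw.2⟩
    have := h.trans (measure_mono hsub)
    rw [volume_Iic_inter_Ioo_zero_one (hv.2.trans hu.2).le,
      ENNReal.ofReal_le_ofReal_iff hv.1.le] at this
    exact absurd hv.2 (not_lt.2 this)
  · intro h
    rw [← volume_Iic_inter_Ioo_zero_one hu.2.le]
    exact measure_mono fun w hw => ⟨(hG hw.2 hu hw.1).trans h, hw.2⟩

lemma quantile_nonneg {μ : Measure ℝ} [IsProbabilityMeasure μ] (h : μ (Iio 0) = 0) {u : ℝ}
    (hu : u ∈ Ioo (0 : ℝ) 1) : 0 ≤ quantile μ u := by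
  by_contra! hlt
  have h0 : μ.real (Iic (quantile μ u)) = 0 := by
    rw [measureReal_def, measure_mono_null (Iic_subset_Iio.2 hlt) h, ENNReal.toReal_zero]
  exact absurd hu.1 (not_lt.2 (h0 ▸ (quantile_le_iff μ hu).1 le_rfl))

/-- The law of `u ↦ max (Q u) (ε u)` stays in the model. -/
lemma map_max_quantile_mem_Fmp {p : ℝ} (hp : 0 < p) {ε : ℝ} (hε : 0 ≤ ε) {ν : Measure ℝ}
    (hν : ν ∈ Fmp p) :
    (volume.restrict (Ioo (0 : ℝ) 1)).map (fun u => max (quantile ν u) (ε * u)) ∈ Fmp p ∧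
    MemLp (fun u => max (quantile ν u) (ε * u)) (ENNReal.ofReal p) (volume.restrict (Ioo 0 1)) ∧
    ∀ u ∈ Ioo (0 : ℝ) 1,
      quantile ((volume.restrict (Ioo (0 : ℝ) 1)).map (fun u => max (quantile ν u) (ε * u))) u =
        max (quantile ν u) (ε * u) := by
  obtain ⟨hmom, hpos, hconv, hmono, hlim⟩ := hν
  have := hmom.1
  set G : ℝ → ℝ := fun u => max (quantile ν u) (ε * u) with hGdef
  have hGmono : MonotoneOn G (Ioo 0 1) := fun u hu v hv huv =>
    max_le_max (hmono hu hv huv) (mul_le_mul_of_nonneg_left huv hε)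
  have hlin : ConvexOn ℝ (Ioo (0 : ℝ) 1) fun u => ε * u :=
    ⟨convex_Ioo 0 1, fun x _ y _ a b _ _ _ => le_of_eq (by simp only [smul_eq_mul]; ring)⟩
  have hGconv : ConvexOn ℝ (Ioo 0 1) G := hconv.sup hlin
  have hGcont : ContinuousOn G (Ioo 0 1) := hGconv.continuousOn isOpen_Ioo
  have hGm : AEMeasurable G (volume.restrict (Ioo 0 1)) :=
    aemeasurable_restrict_of_monotoneOn measurableSet_Ioo hGmono
  have hq : ∀ u ∈ Ioo (0 : ℝ) 1, quantile ((volume.restrict (Ioo (0 : ℝ) 1)).map G) u = G u :=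
    fun u hu => quantile_map hGmono hGcont hu
  have hlinLp : MemLp (fun u : ℝ => ε * u) (ENNReal.ofReal p) (volume.restrict (Ioo 0 1)) := by
    refine MemLp.of_bound (by fun_prop) ε ?_
    filter_upwards [ae_restrict_mem measurableSet_Ioo] with u hu
    rw [Real.norm_eq_abs, abs_of_nonneg (mul_nonneg hε hu.1.le)]
    exact mul_le_of_le_one_right hε hu.2.le
  have hLp : MemLp G (ENNReal.ofReal p) (volume.restrict (Ioo 0 1)) :=
    (memLp_quantile hp hmom).sup hlinLp
  refine ⟨⟨⟨Measure.isProbabilityMeasure_map hGm, ?_⟩, ?_, ?_, ?_, ?_⟩, hLp, hq⟩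
  · rw [integrable_map_measure (by fun_prop (disch := positivity)) hGm]
    exact hLp.integrable_abs_rpow hp
  · rw [Measure.map_apply_of_aemeasurable hGm measurableSet_Iio,
      Measure.restrict_apply' measurableSet_Ioo]
    convert! measure_empty (μ := volume)
    refine eq_empty_of_forall_notMem fun u hu => ?_
    exact absurd (hu.1 : G u < 0)
      (not_lt.2 ((quantile_nonneg hpos hu.2).trans (le_max_left _ _)))
  · exact hGconv.congr fun u hu => (hq u hu).symm
  · exact hGmono.congr fun u hu => (hq u hu).symm
  · have hl : Tendsto (fun u : ℝ => ε * u) (nhdsWithin 0 (Ioi 0)) (nhds 0) :=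
      ((continuous_const.mul continuous_id).tendsto' 0 0 (by simp)).mono_left nhdsWithin_le_nhds
    have : Tendsto G (nhdsWithin 0 (Ioi 0)) (nhds 0) := by simpa using hlim.max hl
    refine this.congr' ?_
    filter_upwards [Ioo_mem_nhdsGT (zero_lt_one' ℝ)] with u hu using (hq u hu).symm

/-- A minimizer of the distance to a measure bounded away from zero has a quantile function
growing at least linearly. -/
lemma mul_le_quantile_of_isMin {p : ℝ} (hp : 0 < p) {μ ν : Measure ℝ}
    (hμ : HasFiniteMomentP p μ) {ε : ℝ} (hε : 0 ≤ ε) (hμε : μ (Iic ε) = 0) (hν : ν ∈ Fmp p)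
    (hmin : ∀ σ ∈ Fmp p, Wdist p ν μ ≤ Wdist p σ μ) {u : ℝ} (hu : u ∈ Ioo (0 : ℝ) 1) :
    ε * u ≤ quantile ν u := by
  by_contra! hlt
  have := hμ.1
  obtain ⟨hmem, hLp, hq⟩ := map_max_quantile_mem_Fmp hp hε hν
  set σ := (volume.restrict (Ioo (0 : ℝ) 1)).map fun u => max (quantile ν u) (ε * u)
  have hμq : ∀ v ∈ Ioo (0 : ℝ) 1, ε < quantile μ v := fun v hv => by
    by_contra! h
    have h1 := (quantile_le_iff μ hv).1 h
    rw [measureReal_def, hμε, ENNReal.toReal_zero] at h1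
    exact absurd hv.1 (not_lt.2 h1)
  have hle : ∀ v ∈ Ioo (0 : ℝ) 1,
      |quantile σ v - quantile μ v| ^ p ≤ |quantile ν v - quantile μ v| ^ p ∧
      (quantile ν v < ε * v →
        |quantile σ v - quantile μ v| ^ p < |quantile ν v - quantile μ v| ^ p) := by
    intro v hv
    rw [hq v hv]
    rcases le_or_gt (ε * v) (quantile ν v) with h | h
    · rw [max_eq_left h]
      exact ⟨le_rfl, fun h' => absurd h (not_le.2 h')⟩
    · have h1 : ε * v ≤ quantile μ v :=
        (mul_le_of_le_one_right hε hv.2.le).trans (hμq v hv).le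
      have : |max (quantile ν v) (ε * v) - quantile μ v| ^ p < |quantile ν v - quantile μ v| ^ p := by
        rw [max_eq_right h.le]
        refine Real.rpow_lt_rpow (abs_nonneg _) ?_ hp
        rw [abs_of_nonpos (by linarith), abs_of_nonpos (by linarith)]
        linarith
      exact ⟨this.le, fun _ => this⟩
  have hIν : Integrable (fun v => |quantile ν v - quantile μ v| ^ p)
      (volume.restrict (Ioo (0 : ℝ) 1)) :=
    ((memLp_quantile hp hν.1).sub (memLp_quantile hp hμ)).integrable_abs_rpow hp
  have hIσ : Integrable (fun v => |quantile σ v - quantile μ v| ^ p)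
      (volume.restrict (Ioo (0 : ℝ) 1)) :=
    ((memLp_quantile hp hmem.1).sub (memLp_quantile hp hμ)).integrable_abs_rpow hp
  have hae : (fun v => |quantile σ v - quantile μ v| ^ p)
      ≤ᵐ[volume.restrict (Ioo (0 : ℝ) 1)] fun v => |quantile ν v - quantile μ v| ^ p := by
    filter_upwards [ae_restrict_mem measurableSet_Ioo] with v hv using (hle v hv).1
  have hint : ∫ v in Ioo (0 : ℝ) 1, |quantile ν v - quantile μ v| ^ p ≤
      ∫ v in Ioo (0 : ℝ) 1, |quantile σ v - quantile μ v| ^ p := by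
    refine (Real.rpow_le_rpow_iff ?_ ?_ (one_div_pos.2 hp)).1 (hmin σ hmem) <;>
      exact integral_nonneg fun v => by positivity
  have heq := (integral_eq_iff_of_ae_le hIσ hIν hae).1
    (le_antisymm (integral_mono_ae hIσ hIν hae) hint)
  have hnot : ∀ᵐ v ∂volume, v ∈ Ioo (0 : ℝ) 1 → ¬ quantile ν v < ε * v := by
    filter_upwards [(ae_restrict_iff' measurableSet_Ioo).1 heq] with v hv hv' h
    exact ((hle v hv').2 h).ne (hv hv')
  have hopen : {v | v ∈ Ioo (0 : ℝ) 1 ∧ quantile ν v < ε * v} ∈ nhds u :=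
    Filter.Eventually.and (isOpen_Ioo.mem_nhds hu)
      (((hν.2.2.1.continuousOn isOpen_Ioo).continuousAt (isOpen_Ioo.mem_nhds hu)).eventually_lt
        (continuous_const.mul continuous_id).continuousAt hlt)
  refine (Measure.measure_pos_of_mem_nhds volume hopen).ne' ?_
  refine measure_mono_null (fun v hv => ?_) hnot
  exact fun h => h hv.1 hv.2

lemma ConvexOn.strictMonoOn_of_tendsto_zero {g : ℝ → ℝ} (hg : ConvexOn ℝ (Ioo 0 1) g)
    (hpos : ∀ u ∈ Ioo (0 : ℝ) 1, 0 < g u) (hlim : Tendsto g (nhdsWithin 0 (Ioi 0)) (nhds 0)) :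
    StrictMonoOn g (Ioo 0 1) := by
  intro u hu v hv huv
  obtain ⟨w, hw, hwu⟩ :=
    ((hlim.eventually (gt_mem_nhds (hpos u hu))).and (Ioo_mem_nhdsGT hu.1)).exists
  have hslope := hg.slope_mono_adjacent ⟨hwu.1, hwu.2.trans hu.2⟩ hv hwu.2 huv
  have h1 : 0 < (g u - g w) / (u - w) := div_pos (sub_pos.2 hw) (sub_pos.2 hwu.2)
  exact sub_pos.1 ((div_pos_iff_of_pos_right (sub_pos.2 huv)).1 (h1.trans_le hslope))

lemma concaveOn_measureReal_Iic {ν : Measure ℝ} [IsProbabilityMeasure ν]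
    (hconv : ConvexOn ℝ (Ioo 0 1) (quantile ν)) (hpos : ∀ x > 0, 0 < ν.real (Iic x)) :
    ConcaveOn ℝ (Ioi 0) fun x => ν.real (Iic x) := by
  refine ⟨convex_Ioi 0, fun x hx y hy a b ha hb hab => ?_⟩
  simp only [smul_eq_mul]
  have hmem : ∀ t ∈ Ioo (0 : ℝ) 1, ∀ z > 0, t * ν.real (Iic z) ∈ Ioo (0 : ℝ) 1 ∧
      quantile ν (t * ν.real (Iic z)) ≤ z := fun t ht z hz => by
    have h1 : t * ν.real (Iic z) ∈ Ioo (0 : ℝ) 1 :=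
      ⟨mul_pos ht.1 (hpos z hz), mul_lt_one_of_nonneg_of_lt_one_left ht.1.le ht.2 measureReal_le_one⟩
    exact ⟨h1, (quantile_le_iff ν h1).2 (mul_le_of_le_one_left measureReal_nonneg ht.2.le)⟩
  have hkey : ∀ t ∈ Ioo (0 : ℝ) 1,
      t * (a * ν.real (Iic x) + b * ν.real (Iic y)) ≤ ν.real (Iic (a * x + b * y)) := by
    intro t ht
    obtain ⟨hx1, hx2⟩ := hmem t ht x hx
    obtain ⟨hy1, hy2⟩ := hmem t ht y hy
    have hc := hconv.2 hx1 hy1 ha hb hab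
    have hz := hconv.1 hx1 hy1 ha hb hab
    simp only [smul_eq_mul] at hc hz
    have := (quantile_le_iff ν hz).1 (hc.trans (add_le_add
      (mul_le_mul_of_nonneg_left hx2 ha) (mul_le_mul_of_nonneg_left hy2 hb)))
    linarith
  have hlim : Tendsto (fun t : ℝ => t * (a * ν.real (Iic x) + b * ν.real (Iic y)))
      (nhdsWithin 1 (Iio 1)) (nhds (a * ν.real (Iic x) + b * ν.real (Iic y))) :=
    ((continuous_id.mul continuous_const).tendsto' 1 _ (by simp)).mono_left nhdsWithin_le_nhds
  refine le_of_tendsto hlim ?_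
  filter_upwards [Ioo_mem_nhdsLT (zero_lt_one' ℝ)] with t ht using hkey t ht

/-- A distribution function which is concave on `(0,∞)` and at most linear at `0` has a
non-increasing density. -/
lemma exists_antitoneOn_density {ν : Measure ℝ} [IsProbabilityMeasure ν] {K : ℝ} (hK : 0 ≤ K)
    (hconc : ConcaveOn ℝ (Ioi 0) fun x => ν.real (Iic x))
    (hneg : ν (Iio 0) = 0) (hle : ∀ x ≥ 0, ν.real (Iic x) ≤ K * x) :
    ∃ f : ℝ → ℝ, (∀ x, 0 ≤ f x) ∧ AntitoneOn f (Ici (0 : ℝ)) ∧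
      ν = volume.withDensity fun x => ENNReal.ofReal (f x) := by
  set F : ℝ → ℝ := fun x => ν.real (Iic x) with hF
  have hFmono : Monotone F := fun a b hab => measureReal_mono (Iic_subset_Iic.2 hab)
  have hF0 : F 0 = 0 := le_antisymm (by simpa using hle 0 le_rfl) measureReal_nonneg
  have hconv : ConvexOn ℝ (Ioi 0) (-F) := hconc.neg
  set D : ℝ → ℝ := fun x => -derivWithin (-F) (Ioi x) x with hD
  have hDderiv : ∀ x > 0, HasDerivWithinAt F (D x) (Ioi x) x := fun x hx => by
    simpa using (hconv.hasDerivWithinAt_rightDeriv_of_mem_interior (x := x)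
      (by simpa using hx)).neg
  have hDanti : ∀ x > 0, ∀ y, x ≤ y → D y ≤ D x := fun x hx y hxy =>
    neg_le_neg (hconv.monotoneOn_rightDeriv (by simpa using hx)
      (by simpa using hx.trans_le hxy) hxy)
  have hDnonneg : ∀ x > 0, 0 ≤ D x := fun x hx => by
    refine le_trans ?_ (hconc.slope_le_of_hasDerivWithinAt_Ioi hx
      (show x + 1 ∈ Ioi 0 from add_pos hx one_pos) (lt_add_one x) (hDderiv x hx))
    rw [slope_def_field]
    exact div_nonneg (sub_nonneg.2 (hFmono (lt_add_one x).le)) (by simp)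
  have hDle : ∀ x > 0, D x ≤ K := fun x hx => by
    have hkey : ∀ w ∈ Ioo 0 x, D x * (x - w) ≤ K * x := fun w hw => by
      have hxi : x ∈ interior (Ioi (0 : ℝ)) := by simpa using hx
      have h1 := (hconv.slope_le_leftDeriv_of_mem_interior hw.1 hxi hw.2).trans
        (hconv.leftDeriv_le_rightDeriv_of_mem_interior hxi)
      rw [slope_def_field, div_le_iff₀ (sub_pos.2 hw.2)] at h1
      have h2 : 0 ≤ F w := measureReal_nonneg
      have h3 := hle x hx.le
      simp only [Pi.neg_apply] at h1
      simp only [hD]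
      linarith
    have hlim : Tendsto (fun w : ℝ => D x * (x - w)) (nhdsWithin 0 (Ioi 0)) (nhds (D x * x)) :=
      ((continuous_const.mul (continuous_const.sub continuous_id)).tendsto' 0 _
        (by simp [hD])).mono_left nhdsWithin_le_nhds
    refine le_of_mul_le_mul_right (le_of_tendsto hlim ?_) hx
    filter_upwards [Ioo_mem_nhdsGT hx] with w hw using hkey w hw
  have hFcont : ContinuousOn F (Ici 0) := by
    intro x hx
    rcases eq_or_lt_of_le (show (0 : ℝ) ≤ x from hx) with rfl | hx
    · have hlim : Tendsto (fun x => K * x) (nhdsWithin 0 (Ici 0)) (nhds 0) :=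
        ((continuous_const.mul continuous_id).tendsto' 0 0 (by simp)).mono_left nhdsWithin_le_nhds
      rw [ContinuousWithinAt, hF0]
      refine tendsto_of_tendsto_of_tendsto_of_le_of_le' tendsto_const_nhds hlim
        (Eventually.of_forall fun _ => measureReal_nonneg) ?_
      filter_upwards [self_mem_nhdsWithin] with x hx using hle x hx
    · exact ((hconc.continuousOn isOpen_Ioi).continuousAt
        (isOpen_Ioi.mem_nhds hx)).continuousWithinAt
  set g : ℝ → ℝ := fun x => if x = 0 then K else D x with hg
  have hgnonneg : ∀ x ∈ Ici (0 : ℝ), 0 ≤ g x := fun x hx => by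
    by_cases h : x = 0
    · simpa [hg, h] using hK
    · simpa [hg, h] using hDnonneg x (lt_of_le_of_ne hx (Ne.symm h))
  have hganti : AntitoneOn g (Ici 0) := by
    intro x hx y hy hxy
    by_cases hx0 : x = 0
    · by_cases hy0 : y = 0
      · simp [hg, hx0, hy0]
      · simpa [hg, hx0, hy0] using hDle y (lt_of_le_of_ne hy (Ne.symm hy0))
    · have hxp : 0 < x := lt_of_le_of_ne hx (Ne.symm hx0)
      simpa [hg, hx0, (hxp.trans_le hxy).ne'] using hDanti x hxp y hxy
  refine ⟨(Ici 0).indicator g, indicator_nonneg hgnonneg, ?_, ?_⟩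
  · intro x hx y hy hxy
    rw [indicator_of_mem hx, indicator_of_mem hy]
    exact hganti hx hy hxy
  refine Measure.ext_of_Iic _ _ fun x => ?_
  have hind : (fun x => ENNReal.ofReal ((Ici 0).indicator g x)) =
      (Ici 0).indicator fun x => ENNReal.ofReal (g x) := by
    ext x
    by_cases h : x ∈ Ici (0 : ℝ) <;> simp [indicator, h]
  rw [withDensity_apply _ measurableSet_Iic, hind, lintegral_indicator measurableSet_Ici,
    Measure.restrict_restrict measurableSet_Ici, Ici_inter_Iic]
  rcases lt_or_ge x 0 with hx | hx
  · rw [Icc_eq_empty (not_le.2 hx), Measure.restrict_empty, lintegral_zero_measure]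
    exact measure_mono_null (Iic_subset_Iio.2 hx) hneg
  have hint : IntegrableOn g (Icc 0 x) :=
    (hganti.mono Icc_subset_Ici_self).integrableOn_isCompact isCompact_Icc
  rw [← ofReal_integral_eq_lintegral_ofReal hint
    (by filter_upwards [ae_restrict_mem measurableSet_Icc] with y hy using hgnonneg y hy.1),
    integral_Icc_eq_integral_Ioc, ← intervalIntegral.integral_of_le hx,
    intervalIntegral.integral_eq_sub_of_hasDeriv_right_of_le_real hx
      (hFcont.mono Icc_subset_Ici_self) (fun y hy => ?_) hint, hF0, sub_zero, ofReal_measureReal]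
  simpa [hg, hy.1.ne'] using hDderiv y hy.1

/-- Proposition 3.4(i). Let `p > 1` and let `μ ∈ P_p([0,∞))` satisfy
`μ([0, ε]) = 0` for some `ε > 0`. Then the Wasserstein projection `μhat` of `μ` onto
`F_{m,p}` (i.e. the minimizer of `ν ↦ W_p(ν, μ)` over `F_{m,p}`) is absolutely continuous
with a non-increasing density on `[0,∞)`; equivalently, its quantile function is strictly
increasing on `(0,1)` with limit `0` at `0+`. -/
theorem wasserstein_projection_monotone_absolutely_continuous
    (p : ℝ) (hp : 1 < p)
    (μ : MeasureTheory.Measure ℝ) (hμ : HasFiniteMomentP p μ)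
    (hμpos : μ (Set.Iio (0:ℝ)) = 0)
    (ε : ℝ) (hε : 0 < ε) (hμε : μ (Set.Icc (0:ℝ) ε) = 0)
    (μhat : MeasureTheory.Measure ℝ)
    (hμhatF : μhat ∈ Fmp p)
    (hμhatmin : ∀ ν ∈ Fmp p, Wdist p μhat μ ≤ Wdist p ν μ) :
    (∃ f : ℝ → ℝ, (∀ x, 0 ≤ f x) ∧ AntitoneOn f (Set.Ici (0:ℝ)) ∧
        μhat = MeasureTheory.volume.withDensity (fun x => ENNReal.ofReal (f x))) ∧
    StrictMonoOn (quantile μhat) (Set.Ioo (0:ℝ) 1) ∧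
    Filter.Tendsto (quantile μhat) (nhdsWithin 0 (Set.Ioi 0)) (nhds 0) := by
  have hp0 : 0 < p := one_pos.trans hp
  have := hμhatF.1.1
  obtain ⟨-, hneg, hconv, -, hlim⟩ := id hμhatF
  have hμIic : μ (Iic ε) = 0 :=
    measure_mono_null (fun x hx => (lt_or_ge x 0).imp id fun h => ⟨h, hx⟩)
      (measure_union_null hμpos hμε)
  have hlin : ∀ u ∈ Ioo (0 : ℝ) 1, ε * u ≤ quantile μhat u := fun u hu =>
    mul_le_quantile_of_isMin hp0 hμ hε.le hμIic hμhatF hμhatmin hu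
  refine ⟨exists_antitoneOn_density (inv_nonneg.2 hε.le)
    (concaveOn_measureReal_Iic hconv fun x hx => ?_) hneg fun x hx => ?_,
    hconv.strictMonoOn_of_tendsto_zero
      (fun u hu => (mul_pos hε hu.1).trans_le (hlin u hu)) hlim, hlim⟩
  · obtain ⟨u, hux, hu⟩ :=
      ((hlim.eventually (gt_mem_nhds hx)).and (Ioo_mem_nhdsGT (zero_lt_one' ℝ))).exists
    exact hu.1.trans_le ((quantile_le_iff μhat hu).1 hux.le)
  · refine le_of_forall_lt_imp_le_of_dense fun u hu => ?_
    rcases le_or_gt u 0 with h0 | h0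
    · exact h0.trans (by positivity)
    have hu' : u ∈ Ioo (0 : ℝ) 1 := ⟨h0, hu.trans_le measureReal_le_one⟩
    rw [inv_mul_eq_div, le_div_iff₀' hε]
    exact (hlin u hu').trans ((quantile_le_iff μhat hu').2 hu.le)
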